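/- Let n ≥ 2 and let t be an element of a commutative ring (e.g. t ∈ ℝ). Then: (i) Σ_{π ∈ S_{n,1}} (−1)^{cdes(π)} t^{π^{-1}(1)} = 2^{n−2} t; (ii) for every i with 2 ≤ i ≤ n−1, Σ_{π ∈ S_{n,i}} (−1)^{cdes(π)} t^{π^{-1}(1)} = 0; (iii) Σ_{π ∈ S_{n,n}} (−1)^{cdes(π)} t^{π^{-1}(1)} = 2^{n−2} t^{n}. Here π^{-1}(1) denotes the index i with π(i) = 1. -/

import Mathlib

open Equiv Finset

/-- Number of excedances of a permutation of `Fin n` (`π i > i`). -/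
def exc {n : ℕ} (π : Equiv.Perm (Fin n)) : ℕ :=
  (Finset.univ.filter fun i => i < π i).card

/-- Number of fixed points. -/
def fixpts {n : ℕ} (π : Equiv.Perm (Fin n)) : ℕ :=
  (Finset.univ.filter fun i => π i = i).card

/-- The set of cycle descents of `π`: those `c` with `π c < c` such that `π c`
is not the smallest element of the cycle containing `c`. -/
def cdesSet {n : ℕ} (π : Equiv.Perm (Fin n)) : Finset (Fin n) :=
  Finset.univ.filter fun c => π c < c ∧ ∃ j, π.SameCycle c j ∧ j < π c

/-- The number of cycle descents of `π`. -/
def cdes {n : ℕ} (π : Equiv.Perm (Fin n)) : ℕ := (cdesSet π).card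

/-- The number of cycles of `π`, counted via cycle minima. -/
def cyc {n : ℕ} (π : Equiv.Perm (Fin n)) : ℕ :=
  (Finset.univ.filter fun c : Fin n => ∀ j, π.SameCycle c j → c ≤ j).card

/-- Extension of `σ` by inserting `i` just before `0`. -/
def insE {n : ℕ} (i : Fin (n+2)) (σ : Equiv.Perm (Fin (n+1))) : Equiv.Perm (Fin (n+2)) :=
  Equiv.swap 0 i * ((finSuccEquiv' i).trans (σ.optionCongr.trans (finSuccEquiv' i).symm))

lemma insE_self {n : ℕ} (i : Fin (n+2)) (σ : Equiv.Perm (Fin (n+1))) : insE i σ i = 0 := by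
  simp [insE]

lemma insE_sa {n : ℕ} (i : Fin (n+2)) (σ : Equiv.Perm (Fin (n+1))) (a : Fin (n+1)) :
    insE i σ (i.succAbove a) = Equiv.swap 0 i (i.succAbove (σ a)) := by
  simp [insE]

lemma insE_sa_ne {n : ℕ} (i : Fin (n+2)) (σ : Equiv.Perm (Fin (n+1))) (a : Fin (n+1))
    (h : i = 0 ∨ σ a ≠ 0) :
    insE i σ (i.succAbove a) = i.succAbove (σ a) := by
  rw [insE_sa]
  by_cases hi : i = 0
  · subst hi; simp
  · have h' : σ a ≠ 0 := by tauto
    apply Equiv.swap_apply_of_ne_of_ne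
    · exact Fin.succAbove_ne_zero hi h'
    · exact Fin.succAbove_ne _ _

lemma insE_sa_eq {n : ℕ} (i : Fin (n+2)) (σ : Equiv.Perm (Fin (n+1))) (a : Fin (n+1))
    (hi : i ≠ 0) (h : σ a = 0) :
    insE i σ (i.succAbove a) = i := by
  rw [insE_sa, h, Fin.succAbove_ne_zero_zero hi]; simp

lemma insE_inj {n : ℕ} (i : Fin (n+2)) : Function.Injective (insE i) := by
  intro σ τ h
  ext1 a
  have := congrArg (fun p : Equiv.Perm (Fin (n+2)) => p (i.succAbove a)) h
  simpa [insE_sa] using this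

lemma insE_surj {n : ℕ} (i : Fin (n+2)) (π : Equiv.Perm (Fin (n+2))) (h : π i = 0) :
    ∃ σ, insE i σ = π := by
  set τ : Equiv.Perm (Option (Fin (n+1))) :=
    (finSuccEquiv' i).symm.trans ((Equiv.swap 0 i * π).trans (finSuccEquiv' i)) with hτ
  refine ⟨Equiv.removeNone τ, ?_⟩
  have h0 : τ none = none := by simp [hτ, h]
  have h1 : (Equiv.removeNone τ).optionCongr = τ := by
    ext1 x
    cases x with
    | none => simp [h0]
    | some a =>
      simp only [Equiv.optionCongr_apply, Option.map_some]
      apply Equiv.removeNone_some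
      have : τ (some a) ≠ none := by
        rw [← h0]; simp
      exact Option.ne_none_iff_exists'.mp this
  unfold insE
  rw [h1]
  ext1 x
  simp [hτ]

/-- one-sided inverse of succAbove -/
def retr {n : ℕ} (i : Fin (n+2)) (x : Fin (n+2)) : Fin (n+1) :=
  (finSuccEquiv' i x).getD 0

lemma retr_sa {n : ℕ} (i : Fin (n+2)) (a) : retr i (i.succAbove a) = a := by simp [retr]
lemma retr_self {n : ℕ} (i : Fin (n+2)) : retr i i = 0 := by simp [retr]

lemma same_aux {α β : Type*} (p : Equiv.Perm α) (q : Equiv.Perm β) (f : α → β)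
    (h : ∀ x, q.SameCycle (f x) (f (p x))) {x y : α} (hs : p.SameCycle x y) :
    q.SameCycle (f x) (f y) := by
  obtain ⟨k, rfl⟩ := hs
  induction k using Int.induction_on with
  | zero => exact Equiv.Perm.SameCycle.refl _ _
  | succ k ih =>
    rw [add_comm, zpow_add, zpow_one, Equiv.Perm.mul_apply]
    exact ih.trans (h _)
  | pred k ih =>
    refine ih.trans (Equiv.Perm.SameCycle.symm ?_)
    have := h ((p ^ (-(k:ℤ) - 1)) x)
    rwa [← Equiv.Perm.mul_apply, ← zpow_one_add, add_sub_cancel] at this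

lemma same_down {n : ℕ} (i : Fin (n+2)) (σ : Equiv.Perm (Fin (n+1))) {x y}
    (h : (insE i σ).SameCycle x y) : σ.SameCycle (retr i x) (retr i y) := by
  refine same_aux _ _ _ ?_ h
  intro x
  rcases Fin.eq_self_or_eq_succAbove i x with rfl | ⟨a, rfl⟩
  · rw [insE_self]
    by_cases hi : x = 0
    · subst hi; exact Equiv.Perm.SameCycle.refl _ _
    · have : retr x 0 = 0 := by
        conv_lhs => rw [← Fin.succAbove_ne_zero_zero hi, retr_sa]
      rw [this, retr_self]
  · by_cases h : i = 0 ∨ σ a ≠ 0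
    · rw [insE_sa_ne _ _ _ h, retr_sa, retr_sa]
      simp [Equiv.Perm.sameCycle_apply_right, Equiv.Perm.SameCycle.refl]
    · push Not at h
      rw [insE_sa_eq _ _ _ h.1 h.2, retr_sa, retr_self, ← h.2]
      simp [Equiv.Perm.sameCycle_apply_right, Equiv.Perm.SameCycle.refl]

lemma same_up {n : ℕ} (i : Fin (n+2)) (σ : Equiv.Perm (Fin (n+1))) {a b}
    (h : σ.SameCycle a b) : (insE i σ).SameCycle (i.succAbove a) (i.succAbove b) := by
  refine same_aux _ _ _ ?_ h
  intro a
  by_cases h : i = 0 ∨ σ a ≠ 0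
  · rw [← insE_sa_ne _ _ _ h]
    simp [Equiv.Perm.sameCycle_apply_right, Equiv.Perm.SameCycle.refl]
  · push Not at h
    have h1 : i.succAbove (σ a) = insE i σ (insE i σ (i.succAbove a)) := by
      rw [insE_sa_eq _ _ _ h.1 h.2, insE_self, h.2, Fin.succAbove_ne_zero_zero h.1]
    rw [h1]
    simp [Equiv.Perm.sameCycle_apply_right, Equiv.Perm.SameCycle.refl]

/-- the cycle descent predicate -/
def CD {n : ℕ} (π : Equiv.Perm (Fin n)) (c : Fin n) : Prop :=
  π c < c ∧ ∃ j, π.SameCycle c j ∧ j < π c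

lemma CD_self {n : ℕ} (i : Fin (n+2)) (σ : Equiv.Perm (Fin (n+1))) : ¬ CD (insE i σ) i := by
  rintro ⟨_, j, _, hj⟩
  rw [insE_self] at hj
  exact absurd hj (Fin.not_lt_zero j)

lemma CD_sa {n : ℕ} (i : Fin (n+2)) (σ : Equiv.Perm (Fin (n+1))) (a : Fin (n+1))
    (h : i = 0 ∨ σ a ≠ 0) : CD (insE i σ) (i.succAbove a) ↔ CD σ a := by
  unfold CD
  rw [insE_sa_ne _ _ _ h, Fin.succAbove_lt_succAbove_iff]
  refine and_congr_right fun _ => ⟨?_, ?_⟩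
  · rintro ⟨j, hj, hlt⟩
    refine ⟨retr i j, ?_, ?_⟩
    · simpa [retr_sa] using same_down i σ hj
    · rcases Fin.eq_self_or_eq_succAbove i j with rfl | ⟨b, rfl⟩
      · rw [retr_self]
        rcases h with rfl | h
        · exfalso
          have h2 := (Equiv.Perm.SameCycle.symm hj).eq_of_left (insE_self 0 σ)
          exact Fin.succAbove_ne _ _ h2.symm
        · exact Fin.pos_of_ne_zero h
      · rw [retr_sa]; exact Fin.succAbove_lt_succAbove_iff.mp hlt
  · rintro ⟨j, hj, hlt⟩
    exact ⟨_, same_up i σ hj, Fin.succAbove_lt_succAbove_iff.mpr hlt⟩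

lemma CD_sa' {n : ℕ} (i : Fin (n+2)) (σ : Equiv.Perm (Fin (n+1))) (a : Fin (n+1))
    (hi : i ≠ 0) (h : σ a = 0) : CD (insE i σ) (i.succAbove a) ↔ i < i.succAbove a := by
  unfold CD
  rw [insE_sa_eq _ _ _ hi h]
  refine and_iff_left_of_imp fun _ => ⟨0, ?_, Fin.pos_of_ne_zero hi⟩
  have h1 : 0 = insE i σ (insE i σ (i.succAbove a)) := by
    rw [insE_sa_eq _ _ _ hi h, insE_self]
  conv => arg 3; rw [h1]
  simp [Equiv.Perm.sameCycle_apply_right, Equiv.Perm.SameCycle.refl]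

open Classical in
lemma sign_eq {n : ℕ} (π : Equiv.Perm (Fin n)) :
    (-1 : ℝ) ^ cdes π = ∏ c, if CD π c then (-1 : ℝ) else 1 := by
  rw [Finset.prod_ite]
  simp only [Finset.prod_const, one_pow, mul_one]
  congr 1
  unfold cdes cdesSet CD
  congr

/-- sign of an insertion -/
noncomputable def eps {n : ℕ} (i : Fin (n+2)) (j : Fin (n+1)) : ℝ :=
  if i ≠ 0 ∧ i < i.succAbove j then -1 else 1

lemma sign_insE {n : ℕ} (i : Fin (n+2)) (σ : Equiv.Perm (Fin (n+1))) :
    (-1 : ℝ) ^ cdes (insE i σ) = eps i (σ.symm 0) * (-1 : ℝ) ^ cdes σ := by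
  classical
  rw [sign_eq, sign_eq, Fin.prod_univ_succAbove _ i, if_neg (CD_self i σ), one_mul]
  have key : ∀ a, (if CD (insE i σ) (i.succAbove a) then (-1 : ℝ) else 1) =
      (if a = σ.symm 0 then eps i (σ.symm 0) else 1) * (if CD σ a then (-1 : ℝ) else 1) := by
    intro a
    by_cases hi : i = 0
    · simp only [CD_sa i σ a (Or.inl hi)]
      simp [eps, hi]
    · by_cases ha : σ a = 0
      · have h1 : a = σ.symm 0 := by rw [← ha]; simp
        have h2 : ¬ CD σ a := by
          rintro ⟨_, j, _, hj⟩
          rw [ha] at hj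
          exact absurd hj (Fin.not_lt_zero j)
        rw [if_pos h1, if_neg h2, ← h1]
        simp only [CD_sa' i σ a hi ha, eps, mul_one, hi, ne_eq, not_false_eq_true, true_and]
      · have h1 : a ≠ σ.symm 0 := by
          rintro rfl; simp at ha
        simp [CD_sa i σ a (Or.inr ha), h1]
  rw [Finset.prod_congr rfl fun a _ => key a, Finset.prod_mul_distrib]
  simp

/-- signed count -/
noncomputable def bb (n : ℕ) (i : Fin (n+1)) : ℝ :=
  ∑ π ∈ Finset.univ.filter (fun π : Equiv.Perm (Fin (n+1)) => π i = 0), (-1 : ℝ) ^ cdes π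

lemma bb_rec (n : ℕ) (i : Fin (n+2)) : bb (n+1) i = ∑ j, eps i j * bb n j := by
  have h1 : bb (n+1) i = ∑ σ : Equiv.Perm (Fin (n+1)), eps i (σ.symm 0) * (-1 : ℝ) ^ cdes σ := by
    unfold bb
    symm
    refine Finset.sum_bij (fun σ _ => insE i σ) ?_ ?_ ?_ ?_
    · intro σ _; simp [insE_self]
    · intro σ _ τ _ h; exact insE_inj i h
    · intro π h
      obtain ⟨σ, hσ⟩ := insE_surj i π (by simpa using h)
      exact ⟨σ, Finset.mem_univ _, hσ⟩
    · intro σ _; exact (sign_insE i σ).symm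
  rw [h1, ← Finset.sum_fiberwise Finset.univ (fun σ : Equiv.Perm (Fin (n+1)) => σ.symm 0)]
  refine Finset.sum_congr rfl fun j _ => ?_
  unfold bb
  rw [Finset.mul_sum]
  refine Finset.sum_congr ?_ ?_
  · ext σ
    simp only [Finset.mem_filter, Finset.mem_univ, true_and]
    rw [Equiv.symm_apply_eq, eq_comm]
  · intro σ hσ
    have : σ j = 0 := by simpa using hσ
    rw [← this]; simp

lemma bb_zero : bb 0 0 = 1 := by
  have h : ∀ σ : Equiv.Perm (Fin (0+1)), cdes σ = 0 := by
    intro σ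
    unfold cdes cdesSet
    simp
  simp [bb, h]
  decide

lemma bb_val (n : ℕ) (i : Fin (n+2)) :
    bb (n+1) i = if i = 0 ∨ i = Fin.last (n+1) then 2 ^ n else 0 := by
  induction n with
  | zero =>
    rw [bb_rec]
    have hb : bb 0 (0 : Fin 1) = 1 := bb_zero
    fin_cases i <;> simp [eps, hb]
  | succ n ih =>
    rw [bb_rec, Fin.sum_univ_succ, Fin.sum_univ_castSucc]
    simp only [ih]
    rw [Finset.sum_eq_zero]
    · simp only [true_or, if_true, Fin.succ_last, or_true, zero_add]
      by_cases h0 : i = 0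
      · subst h0; simp only [eps, ne_eq, not_true_eq_false, false_and, if_false, true_or, if_true]; ring
      · have e0 : eps i 0 = 1 := by
          simp [eps, Fin.succAbove_ne_zero_zero h0]
        rw [e0]
        by_cases hl : i = Fin.last (n+2)
        · subst hl
          simp [eps, Fin.succAbove_last]
          rw [if_neg (by exact not_lt.mpr (Fin.le_last _))]
          try ring
        · have : eps i (Fin.last (n+1)) = -1 := by
            have hlt : i < i.succAbove (Fin.last (n+1)) := by
              rw [Fin.succAbove_ne_last_last hl]
              exact Fin.lt_last_iff_ne_last.mpr hl
            exact if_pos ⟨h0, hlt⟩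
          simp [h0, hl, this]
    · intro j _
      rw [if_neg, mul_zero]
      rintro (h | h)
      · exact Fin.succ_ne_zero _ h
      · have := congrArg Fin.val h
        have := j.2
        simp at *

lemma sum_val (n : ℕ) (i : Fin (n+2)) (t : ℝ) :
    (∑ π ∈ Finset.univ.filter (fun π : Equiv.Perm (Fin (n+2)) => π i = 0),
      (-1 : ℝ) ^ cdes π * t ^ ((π.symm 0).val + 1)) =
    (if i = 0 ∨ i = Fin.last (n+1) then 2 ^ n else 0) * t ^ (i.val + 1) := by
  rw [← bb_val, bb, Finset.sum_mul]
  refine Finset.sum_congr rfl fun π h => ?_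
  have : π i = 0 := by simpa using h
  rw [← this]; simp

/-- For n ≥ 2: Σ_{π ∈ S_{n,i}} (−1)^{cdes(π)} t^{π⁻¹(1)} equals 2^{n−2} t for
i = 1, vanishes for 2 ≤ i ≤ n−1, and equals 2^{n−2} t^n for i = n.  (Element 1
of [n] is 0 : Fin n, position i of [n] is ⟨i−1, _⟩ : Fin n, and π⁻¹(1) is
encoded as (π.symm 0).val + 1.) -/
theorem signed_cdes_position_enumerator_Sni (n : ℕ) (hn : 2 ≤ n) (t : ℝ) :
    (∑ π ∈ Finset.univ.filter
        (fun π : Equiv.Perm (Fin n) => π ⟨0, by omega⟩ = ⟨0, by omega⟩),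
        (-1 : ℝ) ^ cdes π * t ^ ((π.symm ⟨0, by omega⟩).val + 1)) =
      2 ^ (n - 2) * t ∧
    (∀ i : ℕ, ∀ _h2 : 2 ≤ i, ∀ _h1 : i ≤ n - 1,
      (∑ π ∈ Finset.univ.filter
          (fun π : Equiv.Perm (Fin n) => π ⟨i - 1, by omega⟩ = ⟨0, by omega⟩),
          (-1 : ℝ) ^ cdes π * t ^ ((π.symm ⟨0, by omega⟩).val + 1)) = 0) ∧
    (∑ π ∈ Finset.univ.filter
        (fun π : Equiv.Perm (Fin n) => π ⟨n - 1, by omega⟩ = ⟨0, by omega⟩),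
        (-1 : ℝ) ^ cdes π * t ^ ((π.symm ⟨0, by omega⟩).val + 1)) =
      2 ^ (n - 2) * t ^ n := by
  obtain ⟨m, rfl⟩ : ∃ m, n = m + 2 := ⟨n - 2, by omega⟩
  refine ⟨?_, ?_, ?_⟩
  · refine (sum_val m 0 t).trans ?_
    simp
  · intro i h2 h1
    refine (sum_val m ⟨i - 1, by omega⟩ t).trans ?_
    rw [if_neg, zero_mul]
    rintro (h | h)
    · have := congrArg Fin.val h
      simp at this
      omega
    · have := congrArg Fin.val h
      simp at this
      omega
  · refine (sum_val m (Fin.last (m+1)) t).trans ?_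
    simp
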